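/- arXiv:2407.04872 — 2 statements merged into one kernel-verified Lean document; each statement's English description precedes it below -/
import Mathlib

section
/- Let h ∈ ℕ, let s, t ∈ V, and let W be a proper h-hop walk from s to t with ℓ(W) < 0. Then every tail u of a negative edge of W satisfies d^h(s,u) + d^h(u,t) < 0. Consequently, setting B = {u ∈ N : d^h(s,u) + d^h(u,t) < 0}, any set S containing the tails of all negative edges of W contains at least h − 2 elements of B \ {s, t}. -/
open scoped Classical

variable {V : Type*}

/-- `l` is a (nonempty) walk in the edge set `E`: a list of at least one vertex,
with every consecutive pair of vertices being an edge of `E`.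
A single-vertex list is the empty walk at that vertex. -/
def IsWalk (E : Set (V × V)) (l : List V) : Prop :=
  l ≠ [] ∧ l.Chain' (fun a b => (a, b) ∈ E)

/-- `l` is a walk in `E` from `s` to `t`. -/
def IsWalkFrom (E : Set (V × V)) (l : List V) (s t : V) : Prop :=
  IsWalk E l ∧ l.head? = some s ∧ l.getLast? = some t

/-- The edges of a walk, in order, with multiplicity. -/
def walkEdges (l : List V) : List (V × V) := l.zip l.tail

/-- The length of a walk with respect to edge lengths `ℓ`. -/
noncomputable def walkLen (ℓ : V × V → ℝ) (l : List V) : ℝ :=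
  ((walkEdges l).map ℓ).sum

/-- The tails of the negative edges along a walk, in order, with multiplicity. -/
noncomputable def negTails (ℓ : V × V → ℝ) (l : List V) : List V :=
  ((walkEdges l).filter (fun p => ℓ p < 0)).map Prod.fst

/-- The number of hops (negative edges, counted with multiplicity) of a walk. -/
noncomputable def hops (ℓ : V × V → ℝ) (l : List V) : ℕ :=
  (negTails ℓ l).length

/-- The set of negative vertices: tails of negative edges. -/
def negVerts (E : Set (V × V)) (ℓ : V × V → ℝ) : Set V :=
  {u | ∃ v, (u, v) ∈ E ∧ ℓ (u, v) < 0}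

/-- `r`-hop distance: infimum (in the extended reals) of lengths of walks
from `s` to `t` with at most `r` hops. -/
noncomputable def hopDist (E : Set (V × V)) (ℓ : V × V → ℝ) (r : ℕ) (s t : V) : EReal :=
  sInf {x : EReal | ∃ l, IsWalkFrom E l s t ∧ hops ℓ l ≤ r ∧ x = (walkLen ℓ l : ℝ)}

/-- Distance: infimum (in the extended reals) of lengths of all walks from `s` to `t`. -/
noncomputable def dist' (E : Set (V × V)) (ℓ : V × V → ℝ) (s t : V) : EReal :=
  sInf {x : EReal | ∃ l, IsWalkFrom E l s t ∧ x = (walkLen ℓ l : ℝ)}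

/-- Proper `h`-hop distance: infimum of lengths of walks from `s` to `t` with
exactly `h` negative edges whose tails are pairwise distinct. -/
noncomputable def properHopDist (E : Set (V × V)) (ℓ : V × V → ℝ) (h : ℕ) (s t : V) : EReal :=
  sInf {x : EReal | ∃ l, IsWalkFrom E l s t ∧ hops ℓ l = h ∧ (negTails ℓ l).Nodup
    ∧ x = (walkLen ℓ l : ℝ)}

/-- `r`-hop distance from a set of sources. -/
noncomputable def hopDistFromSet (E : Set (V × V)) (ℓ : V × V → ℝ) (r : ℕ) (S : Set V)
    (t : V) : EReal :=
  ⨅ s ∈ S, hopDist E ℓ r s t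

/-- `r`-hop distance to a set of sinks. -/
noncomputable def hopDistToSet (E : Set (V × V)) (ℓ : V × V → ℝ) (r : ℕ) (s : V)
    (T : Set V) : EReal :=
  ⨅ t ∈ T, hopDist E ℓ r s t

/-- `φ` is a valid potential for edge lengths `ℓ`: reweighting introduces no new
negative edges. -/
def ValidPotential (E : Set (V × V)) (ℓ : V × V → ℝ) (φ : V → ℝ) : Prop :=
  ∀ e ∈ E, 0 ≤ ℓ e → 0 ≤ ℓ e + φ e.1 - φ e.2

/-- The reweighted edge lengths `ℓ_φ`. -/
def reweight (ℓ : V × V → ℝ) (φ : V → ℝ) : V × V → ℝ :=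
  fun e => ℓ e + φ e.1 - φ e.2

theorem walkEdges_append_cons (a b : List V) (u : V) :
    walkEdges (a ++ u :: b) = walkEdges (a ++ [u]) ++ walkEdges (u :: b) := by
  induction a with
  | nil => simp [walkEdges]
  | cons x a ih =>
    cases a with
    | nil => simp [walkEdges]
    | cons y a =>
      simp only [walkEdges, List.cons_append, List.tail_cons, List.zip_cons_cons] at ih ⊢
      rw [ih]

theorem walkLen_append_cons (ℓ : V × V → ℝ) (a b : List V) (u : V) :
    walkLen ℓ (a ++ u :: b) = walkLen ℓ (a ++ [u]) + walkLen ℓ (u :: b) := by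
  simp [walkLen, walkEdges_append_cons a b u]

theorem hops_append_cons (ℓ : V × V → ℝ) (a b : List V) (u : V) :
    hops ℓ (a ++ u :: b) = hops ℓ (a ++ [u]) + hops ℓ (u :: b) := by
  simp [hops, negTails, walkEdges_append_cons a b u]

theorem mem_edgeSet_of_mem_walkEdges {E : Set (V × V)} {l : List V} (hl : IsWalk E l)
    {p : V × V} (hp : p ∈ walkEdges l) : p ∈ E := by
  obtain ⟨-, hc⟩ := hl
  induction l with
  | nil => simp [walkEdges] at hp
  | cons x l ih =>
    cases l with
    | nil => simp [walkEdges] at hp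
    | cons y l =>
      obtain ⟨hxy, hc⟩ := List.isChain_cons_cons.1 hc
      rcases List.mem_cons.1 hp with rfl | hp
      · exact hxy
      · exact ih hp hc

theorem IsWalkFrom.exists_split {E : Set (V × V)} {l : List V} {s t u : V}
    (hl : IsWalkFrom E l s t) (hu : u ∈ l) :
    ∃ a b, l = a ++ u :: b ∧ IsWalkFrom E (a ++ [u]) s u ∧ IsWalkFrom E (u :: b) u t := by
  obtain ⟨a, b, rfl⟩ := List.append_of_mem hu
  obtain ⟨⟨-, hc⟩, hs, ht⟩ := hl
  obtain ⟨hc₁, hc₂⟩ := List.isChain_split.1 hc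
  refine ⟨a, b, rfl, ⟨⟨by simp, hc₁⟩, ?_, by simp⟩, ⟨⟨by simp, hc₂⟩, by simp, ?_⟩⟩
  · cases a <;> simpa using hs
  · rwa [List.getLast?_append_of_ne_nil _ (by simp)] at ht

theorem hopDist_le_walkLen {E : Set (V × V)} {ℓ : V × V → ℝ} {r : ℕ} {s t : V} {l : List V}
    (hl : IsWalkFrom E l s t) (hr : hops ℓ l ≤ r) :
    hopDist E ℓ r s t ≤ (walkLen ℓ l : EReal) :=
  sInf_le ⟨l, hl, hr, rfl⟩

/-- Splitting a walk at one of its vertices bounds the sum of the hop distances. -/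
theorem hopDist_add_hopDist_le {E : Set (V × V)} {ℓ : V × V → ℝ} {r : ℕ} {s t u : V}
    {l : List V} (hl : IsWalkFrom E l s t) (hr : hops ℓ l ≤ r) (hu : u ∈ l) :
    hopDist E ℓ r s u + hopDist E ℓ r u t ≤ (walkLen ℓ l : EReal) := by
  obtain ⟨a, b, rfl, ha, hb⟩ := hl.exists_split hu
  rw [hops_append_cons] at hr
  rw [walkLen_append_cons, EReal.coe_add]
  exact add_le_add (hopDist_le_walkLen ha (by omega)) (hopDist_le_walkLen hb (by omega))

theorem mem_negTails {ℓ : V × V → ℝ} {l : List V} {u : V} :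
    u ∈ negTails ℓ l ↔ ∃ v, (u, v) ∈ walkEdges l ∧ ℓ (u, v) < 0 := by
  simp [negTails]

/-- Let `W` be a proper `h`-hop walk from `s` to `t` of negative length.
Then every tail `u` of a negative edge of `W` satisfies `d^h(s,u) + d^h(u,t) < 0`.
Consequently, with `B = {u ∈ N : d^h(s,u) + d^h(u,t) < 0}`, any set `S` containing the
tails of all negative edges of `W` contains at least `h - 2` elements of `B \ {s, t}`. -/
theorem statement4 {V : Type*} [Fintype V] (E : Set (V × V)) (ℓ : V × V → ℝ)
    (h : ℕ) (s t : V) (l : List V) (hW : IsWalkFrom E l s t)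
    (hhops : hops ℓ l = h) (hdistinct : (negTails ℓ l).Nodup)
    (hneg : walkLen ℓ l < 0)
    (B : Set V)
    (hB : B = {u ∈ negVerts E ℓ | hopDist E ℓ h s u + hopDist E ℓ h u t < 0}) :
    (∀ u ∈ negTails ℓ l, hopDist E ℓ h s u + hopDist E ℓ h u t < 0) ∧
    (∀ S : Set V, (∀ u ∈ negTails ℓ l, u ∈ S) →
      h - 2 ≤ (S ∩ (B \ {s, t})).ncard) := by
  have hlt : ∀ u ∈ negTails ℓ l, hopDist E ℓ h s u + hopDist E ℓ h u t < 0 := by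
    intro u hu
    obtain ⟨v, hv, -⟩ := mem_negTails.1 hu
    exact (hopDist_add_hopDist_le hW hhops.le (List.of_mem_zip hv).1).trans_lt
      (by exact_mod_cast hneg)
  refine ⟨hlt, fun S hS => ?_⟩
  have hsub : (((negTails ℓ l).toFinset \ {s, t} : Finset V) : Set V) ⊆ S ∩ (B \ {s, t}) := by
    intro u hu
    simp only [Finset.coe_sdiff, Finset.coe_insert, Finset.coe_singleton, Set.mem_sdiff,
      Finset.mem_coe, List.mem_toFinset] at hu
    obtain ⟨v, hv, hneg'⟩ := mem_negTails.1 hu.1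
    refine ⟨hS u hu.1, ?_, hu.2⟩
    rw [hB]
    exact ⟨⟨v, mem_edgeSet_of_mem_walkEdges hW.1 hv, hneg'⟩, hlt u hu.1⟩
  have hcard := Set.ncard_le_ncard hsub (Set.toFinite _)
  rw [Set.ncard_coe_finset] at hcard
  refine le_trans ?_ hcard
  calc h - 2 ≤ (negTails ℓ l).toFinset.card - ({s, t} : Finset V).card := by
        rw [List.toFinset_card_of_nodup hdistinct, ← hhops]
        exact Nat.sub_le_sub_left Finset.card_le_two _
    _ ≤ _ := Finset.le_card_sdiff _ _
end

section
/- For every r ∈ ℕ and all s, t ∈ V, d^{r+1}(s,t) = min( d^r(s,t), inf_{u ∈ N} ( d^r(s,u) + d^1(u,t) ) ), where the infimum over the empty set is +∞ and any sum involving +∞ is +∞. -/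
open scoped Classical

variable {V : Type*}

theorem isWalkFrom_singleton (E : Set (V × V)) (s : V) : IsWalkFrom E [s] s s := by
  simp [IsWalkFrom, IsWalk, List.Chain']

theorem hops_singleton (ℓ : V × V → ℝ) (s : V) : hops ℓ [s] = 0 := by
  simp [hops, negTails, walkEdges]

theorem walkLen_singleton (ℓ : V × V → ℝ) (s : V) : walkLen ℓ [s] = 0 := by
  simp [walkLen, walkEdges]

theorem hops_cons_cons (ℓ : V × V → ℝ) (a b : V) (l : List V) :
    hops ℓ (a :: b :: l) = (if ℓ (a, b) < 0 then 1 else 0) + hops ℓ (b :: l) := by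
  by_cases h : ℓ (a, b) < 0 <;> simp [hops, negTails, walkEdges, h, add_comm]

theorem walkLen_cons_cons (ℓ : V × V → ℝ) (a b : V) (l : List V) :
    walkLen ℓ (a :: b :: l) = ℓ (a, b) + walkLen ℓ (b :: l) := by
  simp [walkLen, walkEdges]

theorem isWalkFrom_cons_cons {E : Set (V × V)} {a b s t : V} {l : List V} :
    IsWalkFrom E (a :: b :: l) s t ↔ a = s ∧ (a, b) ∈ E ∧ IsWalkFrom E (b :: l) b t := by
  simp [IsWalkFrom, IsWalk, List.Chain']
  tauto

theorem IsWalkFrom.exists_cons {E : Set (V × V)} {s t : V} {l : List V}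
    (h : IsWalkFrom E l s t) : ∃ m, l = s :: m := by
  obtain ⟨⟨hl, -⟩, hs, -⟩ := h
  cases l with
  | nil => exact absurd rfl hl
  | cons a m => exact ⟨m, by simpa using hs⟩

/-- Prepending an edge to a walk. -/
theorem IsWalkFrom.cons {E : Set (V × V)} (ℓ : V × V → ℝ) {a b t : V} {l : List V}
    (hab : (a, b) ∈ E) (h : IsWalkFrom E l b t) :
    IsWalkFrom E (a :: l) a t ∧
      hops ℓ (a :: l) = (if ℓ (a, b) < 0 then 1 else 0) + hops ℓ l ∧
      walkLen ℓ (a :: l) = ℓ (a, b) + walkLen ℓ l := by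
  obtain ⟨m, rfl⟩ := h.exists_cons
  exact ⟨isWalkFrom_cons_cons.2 ⟨rfl, hab, h⟩, hops_cons_cons .., walkLen_cons_cons ..⟩

/-- Induction on walks with a fixed end vertex, by prepending edges. -/
theorem IsWalkFrom.rec_cons {E : Set (V × V)} {t : V} {P : List V → V → Prop}
    (single : P [t] t)
    (cons : ∀ a b l, (a, b) ∈ E → IsWalkFrom E l b t → P l b → P (a :: l) a)
    {l : List V} {s : V} (h : IsWalkFrom E l s t) : P l s := by
  induction l generalizing s with
  | nil => exact absurd rfl h.1.1
  | cons a l ih =>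
    cases l with
    | nil =>
      obtain ⟨-, hs, ht⟩ := h
      simp only [List.head?_cons, Option.some.injEq, List.getLast?_singleton] at hs ht
      subst hs ht
      exact single
    | cons b l =>
      obtain ⟨rfl, hab, hb⟩ := isWalkFrom_cons_cons.1 h
      exact cons _ _ _ hab hb (ih hb)

theorem IsWalkFrom.exists_append {E : Set (V × V)} (ℓ : V × V → ℝ) {s u t : V}
    {l₁ l₂ : List V} (h₁ : IsWalkFrom E l₁ s u) (h₂ : IsWalkFrom E l₂ u t) :
    ∃ l, IsWalkFrom E l s t ∧ hops ℓ l = hops ℓ l₁ + hops ℓ l₂ ∧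
      walkLen ℓ l = walkLen ℓ l₁ + walkLen ℓ l₂ := by
  refine IsWalkFrom.rec_cons (P := fun l₁ s => ∃ l, IsWalkFrom E l s t ∧
    hops ℓ l = hops ℓ l₁ + hops ℓ l₂ ∧ walkLen ℓ l = walkLen ℓ l₁ + walkLen ℓ l₂) ?_ ?_ h₁
  · exact ⟨l₂, h₂, by simp [hops_singleton], by simp [walkLen_singleton]⟩
  · rintro a b m hab hm ⟨l, hl, hh, hw⟩
    obtain ⟨-, hh', hw'⟩ := hm.cons ℓ hab
    obtain ⟨c, ch, cw⟩ := hl.cons ℓ hab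
    exact ⟨a :: l, c, by omega, by linarith⟩

/-- A walk with at most `r + 1` hops has at most `r` hops or splits at the tail of its last
negative edge. -/
theorem IsWalkFrom.hops_le_or_split {E : Set (V × V)} (ℓ : V × V → ℝ) {s t : V} {l : List V}
    (h : IsWalkFrom E l s t) {r : ℕ} (hr : hops ℓ l ≤ r + 1) :
    hops ℓ l ≤ r ∨ ∃ u ∈ negVerts E ℓ, ∃ l₁ l₂, IsWalkFrom E l₁ s u ∧ IsWalkFrom E l₂ u t ∧
      hops ℓ l₁ ≤ r ∧ hops ℓ l₂ ≤ 1 ∧ walkLen ℓ l = walkLen ℓ l₁ + walkLen ℓ l₂ := by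
  revert r
  refine IsWalkFrom.rec_cons (P := fun l s => ∀ {r : ℕ}, hops ℓ l ≤ r + 1 →
    hops ℓ l ≤ r ∨ ∃ u ∈ negVerts E ℓ, ∃ l₁ l₂, IsWalkFrom E l₁ s u ∧ IsWalkFrom E l₂ u t ∧
      hops ℓ l₁ ≤ r ∧ hops ℓ l₂ ≤ 1 ∧ walkLen ℓ l = walkLen ℓ l₁ + walkLen ℓ l₂) ?_ ?_ h
  · intro r _
    exact .inl (by simp [hops_singleton])
  · intro a b l hab hl ih r hr
    obtain ⟨hc, hh, hw⟩ := hl.cons ℓ hab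
    by_cases hneg : ℓ (a, b) < 0
    · rw [if_pos hneg] at hh
      cases r with
      | zero =>
        exact .inr ⟨a, ⟨b, hab, hneg⟩, [a], a :: l, isWalkFrom_singleton E a, hc,
          by simp [hops_singleton], by omega, by simp [walkLen_singleton]⟩
      | succ r =>
        obtain hle | ⟨u, hu, l₁, l₂, h₁, h₂, hh₁, hh₂, hw'⟩ := ih (r := r) (by omega)
        · exact .inl (by omega)
        · obtain ⟨c, ch, cw⟩ := h₁.cons ℓ hab
          rw [if_pos hneg] at ch
          exact .inr ⟨u, hu, a :: l₁, l₂, c, h₂, by omega, hh₂, by linarith⟩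
    · rw [if_neg hneg] at hh
      obtain hle | ⟨u, hu, l₁, l₂, h₁, h₂, hh₁, hh₂, hw'⟩ := ih (r := r) (by omega)
      · exact .inl (by omega)
      · obtain ⟨c, ch, cw⟩ := h₁.cons ℓ hab
        rw [if_neg hneg] at ch
        exact .inr ⟨u, hu, a :: l₁, l₂, c, h₂, by omega, hh₂, by linarith⟩

theorem IsWalkFrom.neg_hops_mul_le_walkLen {E : Set (V × V)} {ℓ : V × V → ℝ} {M : ℝ}
    (hM : ∀ e, -M ≤ ℓ e) {s t : V} {l : List V} (h : IsWalkFrom E l s t) :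
    -(hops ℓ l * M) ≤ walkLen ℓ l := by
  refine IsWalkFrom.rec_cons (P := fun l _ => -(hops ℓ l * M) ≤ walkLen ℓ l) ?_ ?_ h
  · simp [hops_singleton, walkLen_singleton]
  · intro a b l hab hl ih
    obtain ⟨-, hh, hw⟩ := hl.cons ℓ hab
    rw [hh, hw]
    have := hM (a, b)
    split_ifs with hneg
    · push_cast
      linarith
    · push_cast
      linarith

theorem IsWalkFrom.hopDist_le {E : Set (V × V)} {ℓ : V × V → ℝ} {r : ℕ} {s t : V} {l : List V}
    (h : IsWalkFrom E l s t) (hr : hops ℓ l ≤ r) : hopDist E ℓ r s t ≤ (walkLen ℓ l : ℝ) :=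
  sInf_le ⟨l, h, hr, rfl⟩

theorem hopDist_anti (E : Set (V × V)) (ℓ : V × V → ℝ) {r r' : ℕ} (hr : r ≤ r') (s t : V) :
    hopDist E ℓ r' s t ≤ hopDist E ℓ r s t :=
  sInf_le_sInf fun _ ⟨l, h, hl, hx⟩ => ⟨l, h, hl.trans hr, hx⟩

theorem hopDist_ne_bot [Finite V] (E : Set (V × V)) (ℓ : V × V → ℝ) (r : ℕ) (s t : V) :
    hopDist E ℓ r s t ≠ ⊥ := by
  obtain ⟨C, hC⟩ := (Set.finite_range fun e => |ℓ e|).bddAbove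
  have hM : ∀ e, -(max C 0) ≤ ℓ e := fun e => by
    have h₁ : |ℓ e| ≤ C := hC ⟨e, rfl⟩
    have h₂ := neg_abs_le (ℓ e)
    have h₃ := le_max_left C 0
    linarith
  have hle : ((-(r * max C 0) : ℝ) : EReal) ≤ hopDist E ℓ r s t := by
    refine le_sInf ?_
    rintro _ ⟨l, hl, hr, rfl⟩
    refine EReal.coe_le_coe_iff.2 (le_trans ?_ (hl.neg_hops_mul_le_walkLen hM))
    gcongr
  exact ne_bot_of_le_ne_bot (EReal.coe_ne_bot _) hle

theorem hopDist_add_le [Finite V] (E : Set (V × V)) (ℓ : V × V → ℝ) (r r' : ℕ) (s u t : V) :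
    hopDist E ℓ (r + r') s t ≤ hopDist E ℓ r s u + hopDist E ℓ r' u t := by
  refine EReal.le_add_of_forall_gt (.inl (hopDist_ne_bot E ℓ r s u))
    (.inr (hopDist_ne_bot E ℓ r' u t)) fun x hx y hy => ?_
  obtain ⟨_, ⟨l₁, h₁, hh₁, rfl⟩, hx⟩ := sInf_lt_iff.1 hx
  obtain ⟨_, ⟨l₂, h₂, hh₂, rfl⟩, hy⟩ := sInf_lt_iff.1 hy
  obtain ⟨l, hl, hh, hw⟩ := h₁.exists_append ℓ h₂
  calc hopDist E ℓ (r + r') s t ≤ (walkLen ℓ l : ℝ) := hl.hopDist_le (by omega)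
    _ = (walkLen ℓ l₁ : ℝ) + (walkLen ℓ l₂ : ℝ) := by rw [hw, EReal.coe_add]
    _ ≤ x + y := add_le_add hx.le hy.le

/-- The hop-distance recurrence:
`d^{r+1}(s,t) = min (d^r(s,t), inf_{u ∈ N} (d^r(s,u) + d^1(u,t)))`,
where the infimum over the empty set is `+∞`. -/
theorem statement6 {V : Type*} [Fintype V] (E : Set (V × V)) (ℓ : V × V → ℝ)
    (r : ℕ) (s t : V) :
    hopDist E ℓ (r + 1) s t
      = min (hopDist E ℓ r s t)
        (⨅ u ∈ negVerts E ℓ, hopDist E ℓ r s u + hopDist E ℓ 1 u t) := by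
  apply le_antisymm
  · exact le_min (hopDist_anti E ℓ r.le_succ s t)
      (le_iInf₂ fun u _ => hopDist_add_le E ℓ r 1 s u t)
  · refine le_sInf ?_
    rintro _ ⟨l, hl, hr, rfl⟩
    obtain hle | ⟨u, hu, l₁, l₂, h₁, h₂, hh₁, hh₂, hw⟩ := hl.hops_le_or_split ℓ hr
    · exact (min_le_left _ _).trans (hl.hopDist_le hle)
    · refine (min_le_right _ _).trans ((iInf₂_le u hu).trans ?_)
      rw [hw, EReal.coe_add]
      exact add_le_add (h₁.hopDist_le hh₁) (h₂.hopDist_le hh₂)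
end
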